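/- Let T = (Q, Σ, δ) be an S-automaton and 𝐪 ∈ Q⁺ a nonempty state sequence. Then 𝐪∘ is torsion-free in S(T) if and only if there is an ω-word ξ ∈ Σ^ω such that for every i ∈ ℕ the map 𝐪^i∘ is defined on ξ and the ω-words 𝐪^i∘ξ (i ∈ ℕ) are pairwise distinct. If moreover T is a G-automaton, then 𝐪∘ has infinite order in the automaton group G(T) if and only if there is an ω-word ξ ∈ Σ^ω with 𝐪^i∘ξ ≠ ξ for all i > 0. -/

import Mathlib

/- Common framework for automaton semigroups acting on finite and infinite words.

An S-automaton over states `Q` and alphabet `A` is given by a partial deterministic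
transition function `δ : Q → A → Option (A × Q)` (with `δ q a = some (b, p)` encoding
the transition `q –a/b→ p`). -/

namespace AutOrbit

variable {Q A : Type*}

/-- The partial action `q∘` of a single state on a finite word. -/
def stateAct (δ : Q → A → Option (A × Q)) : Q → List A → Option (List A)
  | _, [] => some []
  | q, a :: u => (δ q a).bind fun bp => (stateAct δ bp.2 u).map fun v => bp.1 :: v

/-- The partial action `𝐪∘` of a state sequence `𝐪 = q_n … q_1` (written left-to-right,
head of the list is `q_n`; the rightmost state `q_1` is applied first). -/
def seqAct (δ : Q → A → Option (A × Q)) (l : List Q) (u : List A) : Option (List A) :=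
  l.foldr (fun q acc => acc.bind (stateAct δ q)) (some u)

/-- The length-`n` prefix of an ω-word. -/
def pre (ξ : ℕ → A) (n : ℕ) : List A := List.ofFn fun i : Fin n => ξ i

/-- The `L`-orbit `L∘u` of a finite word `u`. -/
def orbit (δ : Q → A → Option (A × Q)) (L : Set (List Q)) (u : List A) : Set (List A) :=
  {v | ∃ l ∈ L, seqAct δ l u = some v}

/-- The `L`-orbit `L∘ξ` of an ω-word `ξ`: all ω-words `η` such that some `𝐪 ∈ L` is
defined on `ξ` with `𝐪∘ξ = η` (i.e. `𝐪∘` maps every prefix of `ξ` to the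
corresponding prefix of `η`). -/
def omegaOrbit (δ : Q → A → Option (A × Q)) (L : Set (List Q)) (ξ : ℕ → A) :
    Set (ℕ → A) :=
  {η | ∃ l ∈ L, ∀ n, seqAct δ l (pre ξ n) = some (pre η n)}

/-- The set of partial maps `L∘ = {𝐪∘ ∣ 𝐪 ∈ L}`. -/
def mapsOf (δ : Q → A → Option (A × Q)) (L : Set (List Q)) :
    Set (List A → Option (List A)) :=
  {f | ∃ l ∈ L, f = seqAct δ l}

/-- `L ⊆ F*` is suffix-closed over `F`: every `𝐪 ∈ L` factorizes into factors from `F`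
such that every suffix (as a word over the alphabet `F`) of the factorization is
again in `L`. -/
def SuffixClosedOver (F L : Set (List Q)) : Prop :=
  ∀ l ∈ L, ∃ fs : List (List Q),
    (∀ f ∈ fs, f ∈ F) ∧ fs.flatten = l ∧ ∀ i, (fs.drop i).flatten ∈ L

/-- `L` is finitely suffix-closed: suffix-closed over some finite nonempty `F ⊆ Q*`. -/
def FinitelySuffixClosed (L : Set (List Q)) : Prop :=
  ∃ F : Set (List Q), F.Finite ∧ F.Nonempty ∧ SuffixClosedOver F L

/-- `u` has infinite potential w.r.t. `δ` and `L`: the orbit sizes `|L∘ux|` are unbounded. -/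
def InfinitePotential (δ : Q → A → Option (A × Q)) (L : Set (List Q)) (u : List A) : Prop :=
  ∀ C : ℕ, ∃ x : List A, C < (orbit δ L (u ++ x)).ncard

/-- The `i`-th power `𝐪^i` of a state sequence. -/
def listPow (l : List Q) (i : ℕ) : List Q := (List.replicate i l).flatten

/-- `𝐪∘` has torsion: two distinct positive powers induce the same partial map. -/
def HasTorsion (δ : Q → A → Option (A × Q)) (l : List Q) : Prop :=
  ∃ i j : ℕ, 1 ≤ i ∧ 1 ≤ j ∧ i ≠ j ∧ seqAct δ (listPow l i) = seqAct δ (listPow l j)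

/-- The automaton is complete: `δ` is total. -/
def Complete (δ : Q → A → Option (A × Q)) : Prop := ∀ q a, (δ q a).isSome

/-- The automaton is invertible: for every state, the letter-to-output-letter map is a
bijection of the alphabet (each output letter is produced by exactly one input letter). -/
def Invertible (δ : Q → A → Option (A × Q)) : Prop :=
  ∀ q b, ∃! a, ∃ p, δ q a = some (b, p)

/-- A G-automaton: a complete invertible S-automaton. -/
def GAutomaton (δ : Q → A → Option (A × Q)) : Prop := Complete δ ∧ Invertible δ

/-- Reversibility: for every input letter `a` and target state `p` there is at most one
transition `q –a/b→ p`. -/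
def Reversible (δ : Q → A → Option (A × Q)) : Prop :=
  ∀ a p q₁ b₁ q₂ b₂, δ q₁ a = some (b₁, p) → δ q₂ a = some (b₂, p) → q₁ = q₂

/-- Reversibility of the inverse automaton: for every output letter `b` and target
state `p` there is at most one transition `q –a/b→ p`. -/
def InvReversible (δ : Q → A → Option (A × Q)) : Prop :=
  ∀ b p q₁ a₁ q₂ a₂, δ q₁ a₁ = some (b, p) → δ q₂ a₂ = some (b, p) → q₁ = q₂ ∧ a₁ = a₂

/-- Bi-reversibility: the automaton and its inverse automaton are both reversible. -/
def BiReversible (δ : Q → A → Option (A × Q)) : Prop := Reversible δ ∧ InvReversible δ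

/-- The dual automaton `∂T`: states are letters, letters are states; it has a transition
`a –q/p→ b` for every transition `q –a/b→ p` of `T`. -/
def dual (δ : Q → A → Option (A × Q)) : A → Q → Option (Q × A) :=
  fun a q => (δ q a).map fun bp => (bp.2, bp.1)

/-- Adjacency of states in the underlying undirected graph of the automaton. -/
def Adj (δ : Q → A → Option (A × Q)) (q p : Q) : Prop :=
  (∃ a b, δ q a = some (b, p)) ∨ (∃ a b, δ p a = some (b, q))

/-- `P` is (the state set of) a connected component of the automaton. -/
def IsComponent (δ : Q → A → Option (A × Q)) (P : Set Q) : Prop :=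
  ∃ q, P = {p | Relation.ReflTransGen (Adj δ) q p}

/-- The sub-automaton induced on `P` (with all transitions among states of `P`)
is reversible. -/
def SubReversible (δ : Q → A → Option (A × Q)) (P : Set Q) : Prop :=
  ∀ a : A, ∀ p ∈ P, ∀ q₁ b₁ q₂ b₂, q₁ ∈ P → q₂ ∈ P →
    δ q₁ a = some (b₁, p) → δ q₂ a = some (b₂, p) → q₁ = q₂

/-- The inverse of the sub-automaton induced on `P` is reversible. -/
def SubInvReversible (δ : Q → A → Option (A × Q)) (P : Set Q) : Prop :=
  ∀ b : A, ∀ p ∈ P, ∀ q₁ a₁ q₂ a₂, q₁ ∈ P → q₂ ∈ P →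
    δ q₁ a₁ = some (b, p) → δ q₂ a₂ = some (b, p) → q₁ = q₂ ∧ a₁ = a₂

/-- The sub-automaton induced on `P` is bi-reversible. -/
def SubBiReversible (δ : Q → A → Option (A × Q)) (P : Set Q) : Prop :=
  SubReversible δ P ∧ SubInvReversible δ P

/-- For a complete automaton, the (total) action of a state on a finite word. -/
noncomputable def totAct (δ : Q → A → Option (A × Q)) (q : Q) (u : List A) : List A :=
  (stateAct δ q u).getD u

/-- The action of a state of the automaton (`Sum.inl`) or of its inverse automaton
(`Sum.inr`): for a G-automaton, `totAct δ q` is a bijection of `Σ*` and the inverse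
state `q̄` acts as its inverse bijection. -/
noncomputable def gAct (δ : Q → A → Option (A × Q)) : Q ⊕ Q → List A → List A
  | Sum.inl q => totAct δ q
  | Sum.inr q => Function.invFun (totAct δ q)

/-- Action of a sequence over `Q ⊔ Q̄` (rightmost entry applied first). -/
noncomputable def gSeqAct (δ : Q → A → Option (A × Q)) (l : List (Q ⊕ Q)) (u : List A) :
    List A :=
  l.foldr (fun s v => gAct δ s v) u

/-- The automaton group `G(T) = {𝐪∘ ∣ 𝐪 ∈ (Q ⊔ Q̄)⁺}` as a set of maps on `Σ*`. -/
def autGroup (δ : Q → A → Option (A × Q)) : Set (List A → List A) :=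
  {f | ∃ l : List (Q ⊕ Q), l ≠ [] ∧ f = gSeqAct δ l}

/-- The ultimately periodic ω-word `u (a v)^ω`. -/
def ultPer (u : List A) (a : A) (v : List A) (n : ℕ) : A :=
  if h : n < u.length then u.get ⟨n, h⟩
  else (a :: v).get ⟨(n - u.length) % (a :: v).length, Nat.mod_lt _ (by simp)⟩

/-- Run of a single state on a word, returning the output word and the final state. -/
def runState (δ : Q → A → Option (A × Q)) : Q → List A → Option (List A × Q)
  | q, [] => some ([], q)
  | q, a :: u => (δ q a).bind fun bp =>
      (runState δ bp.2 u).map fun vr => (bp.1 :: vr.1, vr.2)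

/-- Run of a state sequence `𝐪` on a word `u`, returning the output word `𝐪∘u` and the
residual state sequence `𝐪·u` (the dual action). -/
def runSeq (δ : Q → A → Option (A × Q)) : List Q → List A → Option (List A × List Q)
  | [], u => some (u, [])
  | q :: l, u => (runSeq δ l u).bind fun vr =>
      (runState δ q vr.1).map fun wp => (wp.1, wp.2 :: vr.2)

/-- Nodes of the `L`-orbital transducer over `F` of `u`: words reached from `u` along a
path of `F`-labeled edges whose reverse label (a word over `F`) lies in `L`. -/
def transNodes (δ : Q → A → Option (A × Q)) (F L : Set (List Q)) (u : List A) :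
    Set (List A) :=
  {v | ∃ fs : List (List Q), (∀ f ∈ fs, f ∈ F) ∧ fs.flatten ∈ L ∧
        ∃ r, runSeq δ fs.flatten u = some (v, r)}

/-- Edges of the `L`-orbital transducer over `F` of `u`: an edge `v –𝐩/𝐨→ w` with
`𝐩 ∈ F`, input label `𝐩`, output label `𝐨 = 𝐩·v`, lying on a path from `u` whose
reverse label is in `L`. -/
def transEdge (δ : Q → A → Option (A × Q)) (F L : Set (List Q)) (u : List A)
    (v : List A) (p o : List Q) (w : List A) : Prop :=
  p ∈ F ∧ ∃ fs : List (List Q), (∀ f ∈ fs, f ∈ F) ∧ (p :: fs).flatten ∈ L ∧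
    (∃ r, runSeq δ fs.flatten u = some (v, r)) ∧ runSeq δ p v = some (w, o)

/-- Isomorphism of the `L`-orbital transducers over `F` of `u₁` and `u₂`: a bijection of
the node sets mapping `u₁` to `u₂` and preserving labeled edges in both directions. -/
def TransducerIso (δ : Q → A → Option (A × Q)) (F L : Set (List Q)) (u₁ u₂ : List A) :
    Prop :=
  ∃ φ : List A → List A,
    Set.BijOn φ (transNodes δ F L u₁) (transNodes δ F L u₂) ∧ φ u₁ = u₂ ∧
    ∀ v ∈ transNodes δ F L u₁, ∀ w ∈ transNodes δ F L u₁, ∀ p o : List Q,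
      (transEdge δ F L u₁ v p o w ↔ transEdge δ F L u₂ (φ v) p o (φ w))


universe u

section Iteration

variable {Z Y : Type*}

/-- The iterates `z, F z, …, F^N z` are pairwise distinct. -/
def DistinctUpTo (F : Z → Z) (z : Z) (N : ℕ) : Prop :=
  Set.InjOn (fun i => F^[i] z) (Set.Iic N)

theorem DistinctUpTo.anti {F : Z → Z} {z : Z} {M N : ℕ} (h : DistinctUpTo F z N)
    (hMN : M ≤ N) : DistinctUpTo F z M :=
  h.mono (Set.Iic_subset_Iic.2 hMN)

theorem exists_iterate_eq_of_not_distinctUpTo {F : Z → Z} {z : Z} {N : ℕ}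
    (h : ¬ DistinctUpTo F z N) : ∃ i j, i < j ∧ j ≤ N ∧ F^[i] z = F^[j] z := by
  simp only [DistinctUpTo, Set.InjOn, Set.mem_Iic] at h
  push Not at h
  obtain ⟨i, hi, j, hj, hij, hne⟩ := h
  rcases lt_or_gt_of_ne hne with h | h
  · exact ⟨i, j, h, hj, hij⟩
  · exact ⟨j, i, h, hi, hij.symm⟩

theorem iterate_add_eq_of_eq {F : Z → Z} {z : Z} {i j : ℕ} (h : F^[i] z = F^[j] z) (k : ℕ) :
    F^[k + i] z = F^[k + j] z := by
  rw [Function.iterate_add_apply, h, ← Function.iterate_add_apply]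

theorem exists_fin_iterate_eq {F : Z → Z} {z : Z} {N : ℕ} (h : ¬ DistinctUpTo F z N) (n : ℕ) :
    ∃ k : Fin (N + 1), F^[k] z = F^[n] z := by
  obtain ⟨i, j, hij, hj, he⟩ := exists_iterate_eq_of_not_distinctUpTo h
  induction n using Nat.strong_induction_on with
  | _ n ih =>
    by_cases hn : n < j
    · exact ⟨⟨n, by omega⟩, rfl⟩
    · obtain ⟨k, hk⟩ := ih (n - j + i) (by omega)
      refine ⟨k, hk.trans ?_⟩
      rw [iterate_add_eq_of_eq he, Nat.sub_add_cancel (by omega)]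

theorem iterate_eq_iterate_add_factorial {F : Z → Z} {z : Z} {N : ℕ}
    (h : ¬ DistinctUpTo F z N) : F^[N] z = F^[N + N.factorial] z := by
  obtain ⟨i, j, hij, hj, he⟩ := exists_iterate_eq_of_not_distinctUpTo h
  have key : ∀ c, F^[N] z = F^[N + c * (j - i)] z := by
    intro c
    induction c with
    | zero => simp
    | succ c ih =>
      rw [ih]
      have := iterate_add_eq_of_eq he (N - i + c * (j - i))
      rwa [show N - i + c * (j - i) + i = N + c * (j - i) by omega,
        show N - i + c * (j - i) + j = N + (c + 1) * (j - i) by rw [add_mul]; omega] at this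
  obtain ⟨c, hc⟩ := Nat.dvd_factorial (show 0 < j - i by omega) (show j - i ≤ N by omega)
  rw [hc, mul_comm]
  exact key c

theorem distinctUpTo_iff_of_semiconj {F : Z → Z} {G : Y → Y} {h : Z → Y} {S : Set Z}
    (hS : Set.MapsTo F S S) (hinj : Set.InjOn h S) (hFG : ∀ z ∈ S, G (h z) = h (F z))
    {z : Z} (hz : z ∈ S) (N : ℕ) : DistinctUpTo F z N ↔ DistinctUpTo G (h z) N := by
  have hmem : ∀ i, F^[i] z ∈ S := fun i => hS.iterate i hz
  have hit : ∀ i, G^[i] (h z) = h (F^[i] z) := by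
    intro i
    induction i with
    | zero => rfl
    | succ i ih =>
      rw [Function.iterate_succ_apply', ih, hFG _ (hmem i), Function.iterate_succ_apply']
  simp only [DistinctUpTo, Set.InjOn, hit]
  exact forall₄_congr fun i _ j _ =>
    imp_congr_left ⟨fun e => congrArg h e, fun e => hinj (hmem i) (hmem j) e⟩

theorem not_forall_distinctUpTo {F : Z → Z} {z : Z} {S : Set Z} (hfin : S.Finite)
    (hS : ∀ i, F^[i] z ∈ S) : ∃ N, ¬ DistinctUpTo F z N := by
  by_contra! hN
  have hinj : Function.Injective fun i => F^[i] z := fun i j hij =>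
    hN (max i j) (Set.mem_Iic.2 (le_max_left _ _)) (Set.mem_Iic.2 (le_max_right _ _)) hij
  exact (Set.infinite_range_of_injective hinj) (hfin.subset (Set.range_subset_iff.2 hS))

end Iteration

theorem exists_pre_eq (w : ℕ → List A) (hlen : ∀ n, (w n).length = n)
    (hpre : ∀ n, w n <+: w (n + 1)) : ∃ ξ : ℕ → A, ∀ n, pre ξ n = w n := by
  have hmono : ∀ m n, m ≤ n → w m <+: w n := fun m n hmn =>
    Nat.le_induction List.prefix_rfl (fun n _ ih => ih.trans (hpre n)) n hmn
  refine ⟨fun i => (w (i + 1))[i]'(by rw [hlen]; omega), fun n => ?_⟩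
  apply List.ext_getElem
  · simp [pre, hlen]
  · intro i h₁ h₂
    simp only [pre, List.getElem_ofFn]
    exact (hmono (i + 1) n (by rw [hlen] at h₂; omega)).getElem _

section Run

variable (δ : Q → A → Option (A × Q))

theorem stateAct_eq_map_runState (q : Q) (u : List A) :
    stateAct δ q u = (runState δ q u).map Prod.fst := by
  induction u generalizing q with
  | nil => rfl
  | cons a u ih =>
    simp only [stateAct, runState]
    cases δ q a <;> simp [ih, Function.comp_def]

theorem stateAct_append (q : Q) (u x : List A) :
    stateAct δ q (u ++ x) =
      (runState δ q u).bind fun wp => (stateAct δ wp.2 x).map fun y => wp.1 ++ y := by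
  induction u generalizing q with
  | nil => simp [runState]
  | cons a u ih =>
    simp only [List.cons_append, stateAct, runState]
    cases δ q a with
    | none => rfl
    | some bp =>
      simp only [Option.bind_some, ih]
      cases runState δ bp.2 u <;> simp [Function.comp_def]

theorem length_of_runState {q p : Q} {u v : List A} (h : runState δ q u = some (v, p)) :
    v.length = u.length := by
  induction u generalizing q v with
  | nil => simp only [runState, Option.some.injEq, Prod.mk.injEq] at h; simp [← h.1]
  | cons a u ih =>
    simp only [runState, Option.bind_eq_some_iff, Option.map_eq_some_iff, Prod.mk.injEq] at h
    obtain ⟨bp, -, ⟨v', p'⟩, h', rfl, rfl⟩ := h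
    simp [ih h']

/-- The partial map `q∘` as a total map fixing the undefined value. -/
def stateMap (q : Q) (o : Option (List A)) : Option (List A) := o.bind (stateAct δ q)

theorem stateMap_iterate_none (q : Q) (i : ℕ) : (stateMap δ q)^[i] none = none :=
  Function.iterate_fixed rfl i

theorem iterate_append {q : Q} {u x z : List A} {i : ℕ}
    (h : (stateMap δ q)^[i] (some (u ++ x)) = some z) :
    ∃ v y, (stateMap δ q)^[i] (some u) = some v ∧ v.length = u.length ∧ z = v ++ y := by
  induction i generalizing z with
  | zero => exact ⟨u, x, rfl, rfl, by simpa using h.symm⟩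
  | succ i ih =>
    rw [Function.iterate_succ_apply'] at h ⊢
    obtain ⟨z', hz', hz⟩ := Option.bind_eq_some_iff.1 h
    obtain ⟨v, y, hv, hvl, rfl⟩ := ih hz'
    rw [stateAct_append] at hz
    obtain ⟨⟨w, p⟩, hw, hz⟩ := Option.bind_eq_some_iff.1 hz
    obtain ⟨y', -, rfl⟩ := Option.map_eq_some_iff.1 hz
    refine ⟨w, y', ?_, (length_of_runState δ hw).trans hvl, rfl⟩
    simp [hv, stateMap, stateAct_eq_map_runState, hw]

theorem length_of_iterate {q : Q} {u v : List A} {i : ℕ}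
    (h : (stateMap δ q)^[i] (some u) = some v) : v.length = u.length := by
  obtain ⟨v', y, hv, hl, rfl⟩ := iterate_append δ (x := []) (by simpa using h)
  rw [h] at hv
  rw [Option.some.inj hv, hl]

theorem iterate_ne_none_of_distinctUpTo {q : Q} {u : List A} {i : ℕ}
    (h : DistinctUpTo (stateMap δ q) (some u) (i + 1)) :
    (stateMap δ q)^[i] (some u) ≠ none := by
  intro hn
  have := h (Set.mem_Iic.2 i.le_succ) (Set.mem_Iic.2 le_rfl)
    (by simp only [Function.iterate_succ_apply', hn]; rfl)
  omega

theorem exists_not_distinctUpTo [Finite A] (q : Q) (u : List A) :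
    ∃ N, ¬ DistinctUpTo (stateMap δ q) (some u) N := by
  refine not_forall_distinctUpTo
    (((List.finite_length_eq A u.length).image some).insert none) fun i => ?_
  cases h : (stateMap δ q)^[i] (some u) with
  | none => exact Set.mem_insert _ _
  | some v => exact Or.inr ⟨v, length_of_iterate δ h, rfl⟩

/-- The suffix `x` is transformed along a finite graph `g` with state-labelled edges. -/
def graphStep {m : ℕ} (g : Fin m → Option (Fin m × Q)) (o : Option (Fin m × List A)) :
    Option (Fin m × List A) :=
  o.bind fun kx => (g kx.1).bind fun kp => (stateAct δ kp.2 kx.2).map fun y => (kp.1, y)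

/-- A word with a small orbit acts on its extensions like one of finitely many graphs. -/
theorem exists_graph (q : Q) (v : List A) (N : ℕ)
    (h : ¬ DistinctUpTo (stateMap δ q) (some v) N) :
    ∃ (g : Fin (N + 1) → Option (Fin (N + 1) × Q)) (k : Fin (N + 1)), ∀ x M,
      DistinctUpTo (stateMap δ q) (some (v ++ x)) M ↔
        DistinctUpTo (graphStep δ g) (some (k, x)) M := by
  set F := stateMap δ q with hF
  have hex : ∀ w : List A, ∃ k : Fin (N + 1), (∃ n, F^[n] (some v) = some w) →
      F^[k] (some v) = some w := by
    intro w
    by_cases hw : ∃ n, F^[n] (some v) = some w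
    · obtain ⟨n, hn⟩ := hw
      obtain ⟨k, hk⟩ := exists_fin_iterate_eq h n
      exact ⟨k, fun _ => hk.trans hn⟩
    · exact ⟨0, fun h => absurd h hw⟩
  choose e he using hex
  let g : Fin (N + 1) → Option (Fin (N + 1) × Q) := fun k =>
    (F^[k] (some v)).bind fun w => (runState δ q w).map fun wp => (e wp.1, wp.2)
  let S : Set (Option (List A)) := {o | ∀ w, o = some w → ∃ v' x, w = v' ++ x ∧
    v'.length = v.length ∧ ∃ n, F^[n] (some v) = some v'}
  let c : List A → Fin (N + 1) × List A := fun w => (e (w.take v.length), w.drop v.length)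
  have hstep : ∀ v' x, v'.length = v.length → (∃ n, F^[n] (some v) = some v') →
      F (some (v' ++ x)) ∈ S ∧
        graphStep δ g ((some (v' ++ x)).map c) = (F (some (v' ++ x))).map c := by
    intro v' x hl hn
    have hgv : g (e v') = (runState δ q v').map fun wp => (e wp.1, wp.2) := by
      simp [g, he v' hn]
    have hFv : F (some (v' ++ x)) = (runState δ q v').bind fun wp =>
        (stateAct δ wp.2 x).map fun y => wp.1 ++ y := stateAct_append δ q v' x
    cases hr : runState δ q v' with
    | none =>
      rw [hr] at hFv hgv
      rw [hFv]
      exact ⟨fun w hw => (nomatch hw), by simp [graphStep, c, ← hl, hgv]⟩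
    | some wp =>
      rw [hr] at hFv hgv
      have hwl : wp.1.length = v.length := (length_of_runState δ hr).trans hl
      rw [hFv]
      constructor
      · intro w hw
        obtain ⟨y, -, rfl⟩ := Option.map_eq_some_iff.1 hw
        obtain ⟨n, hn⟩ := hn
        refine ⟨wp.1, y, rfl, hwl, n + 1, ?_⟩
        rw [Function.iterate_succ_apply', hn]
        simp [hF, stateMap, stateAct_eq_map_runState, hr]
      · have hc : ∀ y, c (wp.1 ++ y) = (e wp.1, y) := fun y => by simp [c, ← hwl]
        have hc' : c (v' ++ x) = (e v', x) := by simp [c, ← hl]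
        simp [graphStep, hc', hgv, hc, Function.comp_def]
  refine ⟨g, e v, fun x M => ?_⟩
  have hconj := distinctUpTo_iff_of_semiconj (F := F) (G := graphStep δ g) (h := Option.map c)
    (S := S) ?_ ?_ ?_ (z := some (v ++ x)) ?_ M
  · simpa [c] using hconj
  · rintro (_ | w) ho
    · intro w hw; cases hw
    · obtain ⟨v', x, rfl, hl, hn⟩ := ho w rfl
      exact (hstep v' x hl hn).1
  · rintro (_ | w₁) h₁ (_ | w₂) h₂ h₁₂
    · rfl
    · cases h₁₂
    · cases h₁₂
    · obtain ⟨v₁, x₁, rfl, hl₁, hn₁⟩ := h₁ w₁ rfl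
      obtain ⟨v₂, x₂, rfl, hl₂, hn₂⟩ := h₂ w₂ rfl
      have hc₁ : c (v₁ ++ x₁) = (e v₁, x₁) := by simp [c, ← hl₁]
      have hc₂ : c (v₂ ++ x₂) = (e v₂, x₂) := by simp [c, ← hl₂]
      simp only [Option.map_some, hc₁, hc₂, Option.some.injEq, Prod.mk.injEq] at h₁₂
      have hv₁ := he v₁ hn₁
      rw [h₁₂.1, he v₂ hn₂] at hv₁
      rw [Option.some.inj hv₁, h₁₂.2]
  · rintro (_ | w) ho
    · rfl
    · obtain ⟨v', x, rfl, hl, hn⟩ := ho w rfl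
      exact (hstep v' x hl hn).2
  · intro w hw
    exact ⟨v, x, (Option.some.inj hw).symm, rfl, 0, rfl⟩

/-- Extensions of `u` have arbitrarily long initial orbit segments without repetition. -/
def Expandable (q : Q) (u : List A) : Prop :=
  ∀ N, ∃ x, DistinctUpTo (stateMap δ q) (some (u ++ x)) N

variable {δ}

theorem Expandable.of_append {q : Q} {u x : List A} (h : Expandable δ q (u ++ x)) :
    Expandable δ q u := fun N => by
  obtain ⟨y, hy⟩ := h N
  exact ⟨x ++ y, by rwa [← List.append_assoc]⟩

theorem Expandable.exists_iterate_eq {q : Q} {u : List A} (h : Expandable δ q u) (i : ℕ) :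
    ∃ v, (stateMap δ q)^[i] (some u) = some v := by
  obtain ⟨x, hx⟩ := h (i + 1)
  obtain ⟨z, hz⟩ := Option.ne_none_iff_exists'.1 (iterate_ne_none_of_distinctUpTo δ hx)
  obtain ⟨v, -, hv, -⟩ := iterate_append δ hz
  exact ⟨v, hv⟩

variable (δ)

theorem Expandable.exists_extension [Finite Q] [Finite A] {q : Q} {u : List A}
    (hu : Expandable δ q u) (N : ℕ) :
    ∃ x, Expandable δ q (u ++ x) ∧ DistinctUpTo (stateMap δ q) (some (u ++ x)) N := by
  by_contra! hcon
  have hbound : ∀ t : (Fin (N + 1) → Option (Fin (N + 1) × Q)) × Fin (N + 1) × A,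
      ∃ B, (∃ M, ∀ y, ¬ DistinctUpTo (graphStep δ t.1) (some (t.2.1, t.2.2 :: y)) M) →
        ∀ y, ¬ DistinctUpTo (graphStep δ t.1) (some (t.2.1, t.2.2 :: y)) B := by
    intro t
    by_cases h : ∃ M, ∀ y, ¬ DistinctUpTo (graphStep δ t.1) (some (t.2.1, t.2.2 :: y)) M
    · obtain ⟨M, hM⟩ := h
      exact ⟨M, fun _ => hM⟩
    · exact ⟨0, fun h' => absurd h' h⟩
  choose B hB using hbound
  obtain ⟨C, hC⟩ := (Set.finite_range B).bddAbove
  have key : ∀ y x, Expandable δ q (u ++ x) →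
      ¬ DistinctUpTo (stateMap δ q) (some (u ++ x ++ y)) (max N C) := by
    intro y
    induction y with
    | nil =>
      intro x hx hd
      rw [List.append_nil] at hd
      exact hcon x hx (hd.anti (le_max_left _ _))
    | cons a y ih =>
      intro x hx hd
      by_cases ha : Expandable δ q (u ++ (x ++ [a]))
      · exact ih _ ha (by simpa using hd)
      · obtain ⟨g, k, hg⟩ := exists_graph δ q (u ++ x) N (hcon x hx)
        simp only [Expandable] at ha
        push Not at ha
        obtain ⟨M, hM⟩ := ha
        refine hB (g, k, a) ⟨M, fun y' hy' => hM y' ?_⟩ y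
          (((hg _ _).1 hd).anti ((hC ⟨_, rfl⟩).trans (le_max_right _ _)))
        simpa using (hg (a :: y') M).2 hy'
  obtain ⟨y, hy⟩ := hu (max N C)
  exact key y [] (by simpa using hu) (by simpa using hy)

theorem exists_omega_word [Finite Q] [Finite A] {q : Q}
    (h : ∀ N, ∃ u, DistinctUpTo (stateMap δ q) (some u) N) :
    ∃ ξ : ℕ → A, (∀ n, Expandable δ q (pre ξ n)) ∧
      ∀ N, ∃ n, DistinctUpTo (stateMap δ q) (some (pre ξ n)) N := by
  have hnext : ∀ (u : {u : List A // Expandable δ q u}) (N : ℕ),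
      ∃ v : {v : List A // Expandable δ q v}, u.1 <+: v.1 ∧ u.1.length < v.1.length ∧
        DistinctUpTo (stateMap δ q) (some v.1) N := by
    rintro ⟨u, hu⟩ N
    obtain ⟨M, hM⟩ := exists_not_distinctUpTo δ q u
    obtain ⟨x, hx, hd⟩ := hu.exists_extension δ (max N M)
    refine ⟨⟨u ++ x, hx⟩, List.prefix_append _ _, ?_, hd.anti (le_max_left _ _)⟩
    rcases x with _ | ⟨a, x⟩
    · exact absurd (hd.anti (le_max_right _ _)) (by simpa using hM)
    · simp
  choose next hpre hlt hd using hnext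
  let c : ℕ → {u : List A // Expandable δ q u} := fun n =>
    Nat.rec ⟨[], by simpa [Expandable] using h⟩ (fun n u => next u n) n
  have hc : ∀ n, c (n + 1) = next (c n) n := fun _ => rfl
  have hlen : ∀ n, n ≤ (c n).1.length := by
    intro n
    induction n with
    | zero => exact Nat.zero_le _
    | succ n ih => rw [hc]; exact ih.trans_lt (hlt _ _)
  have hmono : ∀ m n, m ≤ n → (c m).1 <+: (c n).1 := fun m n hmn =>
    Nat.le_induction List.prefix_rfl (fun n _ ih => ih.trans (hpre (c n) n)) n hmn
  obtain ⟨ξ, hξ⟩ := exists_pre_eq (fun n => (c n).1.take n) (by simpa using hlen) (fun n => by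
    refine List.prefix_of_prefix_length_le
      (List.IsPrefix.trans ⟨_, List.take_append_drop _ _⟩ (hmono n (n + 1) n.le_succ))
      ⟨_, List.take_append_drop _ _⟩ ?_
    have := hlen n
    have := hlen (n + 1)
    simp only [List.length_take]
    omega)
  refine ⟨ξ, fun n => ?_, fun N => ⟨(c (N + 1)).1.length, ?_⟩⟩
  · rw [hξ]
    exact Expandable.of_append (x := (c n).1.drop n)
      (by rw [List.take_append_drop]; exact (c n).2)
  · have hp : pre ξ (c (N + 1)).1.length = (c (N + 1)).1 := by
      rw [hξ]
      exact (List.prefix_iff_eq_take.1 (hmono (N + 1) _ (hlen (N + 1)))).symm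
    rw [hp]
    exact hd (c N) N

theorem exists_omega_orbit [Finite Q] [Finite A] {q : Q}
    (h : ∀ N, ∃ u, DistinctUpTo (stateMap δ q) (some u) N) :
    ∃ (ξ : ℕ → A) (η : ℕ → ℕ → A),
      (∀ i n : ℕ, (stateMap δ q)^[i] (some (pre ξ n)) = some (pre (η i) n)) ∧
      Function.Injective η := by
  obtain ⟨ξ, hexp, hdist⟩ := exists_omega_word δ h
  choose w hw using fun i n => (hexp n).exists_iterate_eq i
  have hlen : ∀ i n, (w i n).length = n := fun i n => by
    simpa [pre] using length_of_iterate δ (hw i n)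
  have hη : ∀ i, ∃ η : ℕ → A, ∀ n, pre η n = w i n := fun i =>
    exists_pre_eq (w i) (hlen i) fun n => by
      have hs : pre ξ (n + 1) = pre ξ n ++ [ξ n] := by
        rw [pre, List.ofFn_succ_last]
        rfl
      have h1 := hw i (n + 1)
      rw [hs] at h1
      obtain ⟨v, y, hv, -, hy⟩ := iterate_append δ h1
      rw [hw i n] at hv
      rw [hy, Option.some.inj hv]
      exact List.prefix_append _ _
  choose η hη using hη
  refine ⟨ξ, η, fun i n => by rw [hw, hη], fun i j hij => ?_⟩
  obtain ⟨n, hn⟩ := hdist (max i j)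
  refine hn (Set.mem_Iic.2 (le_max_left _ _)) (Set.mem_Iic.2 (le_max_right _ _)) ?_
  simp only [hw, ← hη, hij]

/-- A state sequence acts as a single state of some finite automaton. -/
theorem exists_stateAct_eq_seqAct {Q : Type u} [Finite Q] {A : Type*}
    (δ : Q → A → Option (A × Q)) (l : List Q) :
    ∃ (S : Type u) (_ : Finite S) (ε : S → A → Option (A × S)) (s : S),
      ∀ u, stateAct ε s u = seqAct δ l u := by
  induction l with
  | nil =>
    refine ⟨PUnit, inferInstance, fun s a => some (a, s), PUnit.unit, fun u => ?_⟩
    induction u with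
    | nil => rfl
    | cons a u ih =>
      simp only [stateAct, Option.bind_some, ih]
      rfl
  | cons q l ih =>
    obtain ⟨S, hS, ε, s, hs⟩ := ih
    let μ : Q × S → A → Option (A × (Q × S)) := fun qs a =>
      (ε qs.2 a).bind fun bs => (δ qs.1 bs.1).map fun cp => (cp.1, (cp.2, bs.2))
    have hμ : ∀ u q s, stateAct μ (q, s) u = (stateAct ε s u).bind (stateAct δ q) := by
      intro u
      induction u with
      | nil => intro q s; rfl
      | cons a u ih =>
        intro q s
        simp only [stateAct, μ]
        cases ε s a with
        | none => rfl
        | some bs =>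
          simp only [Option.bind_some]
          cases hq : δ q bs.1 with
          | none =>
            cases stateAct ε bs.2 u <;> simp [stateAct, hq]
          | some cp =>
            simp only [Option.map_some, Option.bind_some]
            rw [ih]
            cases stateAct ε bs.2 u <;> simp [stateAct, hq]
    refine ⟨Q × S, inferInstance, μ, (q, s), fun u => ?_⟩
    rw [hμ, hs]
    rfl

theorem seqAct_listPow (l : List Q) (i : ℕ) (u : List A) :
    seqAct δ (listPow l i) u = (fun o : Option (List A) => o.bind (seqAct δ l))^[i] (some u) := by
  have hbind : ∀ (l : List Q) (o : Option (List A)),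
      l.foldr (fun q acc => acc.bind (stateAct δ q)) o = o.bind (seqAct δ l) := by
    intro l o
    cases o with
    | some u => rfl
    | none => induction l with
      | nil => rfl
      | cons q l ih => rw [List.foldr_cons, ih]; rfl
  induction i with
  | zero => rfl
  | succ i ih =>
    have : listPow l (i + 1) = l ++ listPow l i := by simp [listPow, List.replicate_succ]
    rw [this, Function.iterate_succ_apply', ← ih, seqAct, List.foldr_append, hbind]
    rfl

variable {δ}

theorem GAutomaton.bind_stateAct_injective (h : GAutomaton δ) (q : Q) :
    Function.Injective fun o : Option (List A) => o.bind (stateAct δ q) := by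
  have hsome : ∀ (u : List A) (q : Q), ∃ v, stateAct δ q u = some v := by
    intro u
    induction u with
    | nil => exact fun q => ⟨[], rfl⟩
    | cons a u ih =>
      intro q
      obtain ⟨bp, hbp⟩ := Option.isSome_iff_exists.1 (h.1 q a)
      obtain ⟨v, hv⟩ := ih bp.2
      exact ⟨bp.1 :: v, by simp [stateAct, hbp, hv]⟩
  have hinj : ∀ (u v w : List A) (q : Q), stateAct δ q u = some w → stateAct δ q v = some w →
      u = v := by
    intro u
    induction u with
    | nil =>
      rintro (_ | ⟨a, v⟩) w q hu hv
      · rfl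
      · simp only [stateAct, Option.some.injEq, Option.bind_eq_some_iff,
          Option.map_eq_some_iff] at hu hv
        obtain ⟨bp, -, v', -, rfl⟩ := hv
        cases hu
    | cons a u ih =>
      rintro (_ | ⟨a', v⟩) w q hu hv
      · simp only [stateAct, Option.some.injEq, Option.bind_eq_some_iff,
          Option.map_eq_some_iff] at hu hv
        obtain ⟨bp, -, v', -, rfl⟩ := hu
        cases hv
      · simp only [stateAct, Option.bind_eq_some_iff, Option.map_eq_some_iff] at hu hv
        obtain ⟨⟨b, p⟩, hb, u', hu', rfl⟩ := hu
        obtain ⟨⟨b', p'⟩, hb', v', hv', hw⟩ := hv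
        obtain ⟨rfl, rfl⟩ := List.cons.inj hw
        obtain rfl := (h.2 q b').unique ⟨p, hb⟩ ⟨p', hb'⟩
        rw [hb] at hb'
        cases hb'
        rw [ih v _ p hu' hv']
  rintro (_ | u) (_ | v) huv
  · rfl
  · obtain ⟨w, hw⟩ := hsome v q
    simp [hw] at huv
  · obtain ⟨w, hw⟩ := hsome u q
    simp [hw] at huv
  · obtain ⟨w, hw⟩ := hsome u q
    simp only [Option.bind_some] at huv
    rw [hinj u v w q hw (huv ▸ hw)]

theorem GAutomaton.bind_seqAct_injective (h : GAutomaton δ) (l : List Q) :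
    Function.Injective fun o : Option (List A) => o.bind (seqAct δ l) := by
  induction l with
  | nil =>
    have : (fun o : Option (List A) => o.bind (seqAct δ [])) = id := by
      funext o; cases o <;> rfl
    rw [this]
    exact Function.injective_id
  | cons q l ih =>
    have : (fun o : Option (List A) => o.bind (seqAct δ (q :: l))) =
        (fun o => o.bind (stateAct δ q)) ∘ fun o => o.bind (seqAct δ l) := by
      funext o; cases o <;> rfl
    rw [this]
    exact (h.bind_stateAct_injective q).comp ih

theorem GAutomaton.exists_power_eq_id_of_hasTorsion (h : GAutomaton δ) {l : List Q}
    (ht : HasTorsion δ l) : ∃ i, 1 ≤ i ∧ ∀ u, seqAct δ (listPow l i) u = some u := by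
  have main : ∀ i j, i < j → seqAct δ (listPow l i) = seqAct δ (listPow l j) →
      ∃ i, 1 ≤ i ∧ ∀ u, seqAct δ (listPow l i) u = some u := by
    intro i j hij he
    refine ⟨j - i, by omega, fun u => ?_⟩
    have hu := congrFun he u
    rw [seqAct_listPow, seqAct_listPow, ← Nat.add_sub_cancel' hij.le,
      Function.iterate_add_apply] at hu
    rw [seqAct_listPow]
    exact ((h.bind_seqAct_injective l).iterate i hu).symm
  obtain ⟨i, j, -, -, hne, he⟩ := ht
  rcases lt_or_gt_of_ne hne with hij | hij
  · exact main i j hij he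
  · exact main j i hij he.symm

theorem exists_witness_of_not_hasTorsion [Finite Q] [Finite A] {l : List Q}
    (ht : ¬ HasTorsion δ l) :
    ∃ (ξ : ℕ → A) (η : ℕ → ℕ → A),
      (∀ i n : ℕ, seqAct δ (listPow l i) (pre ξ n) = some (pre (η i) n)) ∧
      Function.Injective η := by
  obtain ⟨S, hS, ε, s, hs⟩ := exists_stateAct_eq_seqAct δ l
  have hpow : ∀ i u, seqAct δ (listPow l i) u = (stateMap ε s)^[i] (some u) := by
    intro i u
    rw [seqAct_listPow, ← funext hs]
    rfl
  simp only [hpow]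
  apply exists_omega_orbit
  by_contra! hN
  obtain ⟨N, hN⟩ := hN
  refine ht ⟨N + 1, N + 1 + (N + 1).factorial, by omega, by omega, ?_, funext fun u => ?_⟩
  · have := Nat.factorial_pos (N + 1)
    omega
  · rw [hpow, hpow]
    exact iterate_eq_iterate_add_factorial fun hd => hN u (hd.anti N.le_succ)

end Run

/-- `𝐪∘` is torsion-free in `S(T)` iff there is an ω-word `ξ` such that
all powers `𝐪^i∘` are defined on `ξ` and the ω-words `𝐪^i∘ξ` are pairwise distinct.
If, moreover, `T` is a G-automaton, then `𝐪∘` has infinite order in `G(T)` (no positive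
power is the identity) iff there is an ω-word `ξ` with `𝐪^i∘ξ ≠ ξ` for all `i > 0`. -/
theorem torsionFree_iff_witness_word {Q A : Type*} [Fintype Q] [Fintype A] [Nonempty A]
    (δ : Q → A → Option (A × Q)) (l : List Q) (hl : l ≠ []) :
    ((¬ HasTorsion δ l) ↔
      ∃ (ξ : ℕ → A) (η : ℕ → ℕ → A),
        (∀ i n : ℕ, seqAct δ (listPow l i) (pre ξ n) = some (pre (η i) n)) ∧
        Function.Injective η) ∧
    (GAutomaton δ →
      ((∀ i : ℕ, 1 ≤ i → ¬ ∀ u : List A, seqAct δ (listPow l i) u = some u) ↔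
        ∃ ξ : ℕ → A, ∀ i : ℕ, 1 ≤ i →
          ∃ n : ℕ, seqAct δ (listPow l i) (pre ξ n) ≠ some (pre ξ n))) := by
  have hpre : ∀ ξ η : ℕ → A, (∀ n, pre ξ n = pre η n) → ξ = η := fun ξ η h => by
    funext k
    have := List.ofFn_injective (h (k + 1))
    exact congrFun this ⟨k, k.lt_succ_self⟩
  refine ⟨⟨exists_witness_of_not_hasTorsion, ?_⟩, fun hG => ⟨fun hord => ?_, ?_⟩⟩
  · rintro ⟨ξ, η, hη, hinj⟩ ⟨i, j, -, -, hne, he⟩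
    refine hne (hinj (hpre _ _ fun n => Option.some.inj ?_))
    rw [← hη, ← hη, he]
  · obtain ⟨ξ, η, hη, hinj⟩ := exists_witness_of_not_hasTorsion (δ := δ) (l := l) fun ht => by
      obtain ⟨i, hi, hid⟩ := hG.exists_power_eq_id_of_hasTorsion ht
      exact hord i hi hid
    refine ⟨ξ, fun i hi => ?_⟩
    by_contra! hfix
    have : η i = η 0 := hpre _ _ fun n => Option.some.inj <| by
      rw [← hη, ← hη, hfix n]
      rfl
    have := hinj this
    omega
  · rintro ⟨ξ, hξ⟩ i hi hid
    obtain ⟨n, hn⟩ := hξ i hi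
    exact hn (hid _)

end AutOrbit
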